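/- arXiv:2305.08128 — 10 statements merged into one kernel-verified Lean document; each statement's English description precedes it below -/
import Mathlib

section
/- Let β ∈ ℝ \ {0}, γ > 0, and let m : ℝ → ℝ be differentiable on (0,∞) with m' differentiable at a point k > 0. Then the modulational instability index satisfies the identity 4·k⁵·Δ(k) = (2γ + β·k³·(k·m''(k) + 2·m'(k))) · (3γ + 4·β·k²·(m(k) − m(2k))). In particular, Δ(k) < 0 if and only if the two factors 2γ + β·k³·(k·m''(k) + 2·m'(k)) and 3γ + 4·β·k²·(m(k) − m(2k)) have strictly opposite signs. -/
/-- Modulational instability index identity for the generalized Ostrovsky equation: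
`4·k⁵·Δ(k) = (2γ + β·k³·(k·m''(k) + 2·m'(k))) · (3γ + 4·β·k²·(m(k) − m(2k)))`,
and `Δ(k) < 0` iff the two factors have strictly opposite signs. Here
`c_p(x) = β·m(x) + γ/x²`, `c_g(x) = β·(m(x) + x·m'(x)) − γ/x²` and
`Δ(x) = (c_p(x) − c_p(2x))·c_g'(x)`. -/
theorem stmt_0 (β γ k : ℝ) (m : ℝ → ℝ)
    (hβ : β ≠ 0) (hγ : 0 < γ) (hk : 0 < k)
    (hm : DifferentiableOn ℝ m (Set.Ioi (0 : ℝ)))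
    (hm' : DifferentiableAt ℝ (deriv m) k) :
    let cp : ℝ → ℝ := fun x => β * m x + γ / x ^ 2
    let cg : ℝ → ℝ := fun x => β * (m x + x * deriv m x) - γ / x ^ 2
    let Δ : ℝ → ℝ := fun x => (cp x - cp (2 * x)) * deriv cg x
    let F₁ : ℝ := 2 * γ + β * k ^ 3 * (k * deriv (deriv m) k + 2 * deriv m k)
    let F₂ : ℝ := 3 * γ + 4 * β * k ^ 2 * (m k - m (2 * k))
    4 * k ^ 5 * Δ k = F₁ * F₂ ∧
      (Δ k < 0 ↔ (0 < F₁ ∧ F₂ < 0) ∨ (F₁ < 0 ∧ 0 < F₂)) := by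
  intro cp cg Δ F₁ F₂
  have hk0 : k ≠ 0 := hk.ne'
  have hmk : HasDerivAt m (deriv m k) k :=
    (hm.differentiableAt (Ioi_mem_nhds hk)).hasDerivAt
  have hcg : HasDerivAt cg
      (β * (deriv m k + (1 * deriv m k + k * deriv (deriv m) k))
        - (0 * k ^ 2 - γ * (((2 : ℕ) : ℝ) * k ^ (2 - 1))) / (k ^ 2) ^ 2) k :=
    ((hmk.add ((hasDerivAt_id k).mul hm'.hasDerivAt)).const_mul β).sub
      ((hasDerivAt_const k γ).div (hasDerivAt_pow 2 k) (pow_ne_zero 2 hk0))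
  have key : 4 * k ^ 5 * Δ k = F₁ * F₂ := by
    simp only [Δ, hcg.deriv, cp, F₁, F₂]
    field_simp
    push_cast
    ring
  refine ⟨key, ?_⟩
  have hpos : 0 < 4 * k ^ 5 := by positivity
  rw [← mul_neg_iff, ← key, ← smul_eq_mul, smul_neg_iff_of_pos_left hpos]
end

section
/- Fix γ > 0 and β < 0, and for k > 0 define Δ(k) = (3βk² + 3γ/(4k²)) · (−6βk + 2γ/k³) (the modulational instability index of the Ostrovsky equation, corresponding to the symbol m(k) = 1 − k²). Then Δ(k) < 0 if and only if k > (γ/(4|β|))^{1/4}, and Δ(k) > 0 for all 0 < k < (γ/(4|β|))^{1/4}. -/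
/-- For the Ostrovsky equation (symbol `m(k) = 1 − k²`) with `γ > 0`, `β < 0`,
the modulational instability index
`Δ(k) = (3βk² + 3γ/(4k²))·(−6βk + 2γ/k³)` is negative iff `k > (γ/(4|β|))^(1/4)`,
and positive for `0 < k < (γ/(4|β|))^(1/4)`. -/
theorem stmt_2 (γ β : ℝ) (hγ : 0 < γ) (hβ : β < 0) :
    ∀ k : ℝ, 0 < k →
      (((3 * β * k ^ 2 + 3 * γ / (4 * k ^ 2)) * (-6 * β * k + 2 * γ / k ^ 3) < 0) ↔
        (γ / (4 * |β|)) ^ ((1 : ℝ) / 4) < k) ∧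
      (k < (γ / (4 * |β|)) ^ ((1 : ℝ) / 4) →
        0 < (3 * β * k ^ 2 + 3 * γ / (4 * k ^ 2)) * (-6 * β * k + 2 * γ / k ^ 3)) := by
  intro k hk
  set a : ℝ := (γ / (4 * |β|)) ^ ((1 : ℝ) / 4) with ha
  have hq : 0 ≤ γ / (4 * |β|) := by positivity
  have ha0 : 0 ≤ a := Real.rpow_nonneg hq _
  have ha4 : a ^ 4 = γ / (4 * -β) := by
    rw [ha, ← Real.rpow_natCast, ← Real.rpow_mul hq, abs_of_neg hβ]
    norm_num
  have hγa : γ = 4 * -β * a ^ 4 := by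
    rw [ha4, mul_div_cancel₀ _ (by linarith : 4 * -β ≠ 0)]
  have hβ' : 0 < -β := neg_pos.mpr hβ
  have hgroup : 0 < -6 * β * k + 2 * γ / k ^ 3 := by
    have : 0 < -β * k := mul_pos hβ' hk
    have : 0 < 2 * γ / k ^ 3 := by positivity
    linarith
  have hphase : 3 * β * k ^ 2 + 3 * γ / (4 * k ^ 2) = 3 * -β / k ^ 2 * (a ^ 4 - k ^ 4) := by
    rw [hγa]
    field_simp
    ring
  have hcoeff : 0 < 3 * -β / k ^ 2 := by positivity
  have hpos := mul_pos hcoeff hgroup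
  rw [hphase, mul_right_comm, ← smul_eq_mul, smul_neg_iff_of_pos_left hpos,
    smul_pos_iff_of_pos_left hpos, sub_neg, sub_pos]
  exact ⟨pow_lt_pow_iff_left₀ ha0 hk.le (by norm_num),
    fun h => pow_lt_pow_left₀ h hk.le (by norm_num)⟩
end

section
/- Fix γ > 0, β > 0 and δ > 1/2, and for k > 0 define Δ(k) = (β(2^δ − 1)k^δ + 3γ/(4k²)) · (−βδ(1+δ)k^{δ−1} + 2γ/k³) (the modulational instability index of the Ostrovsky–fKdV equation, corresponding to the symbol m(k) = 1 − k^δ for k > 0). Then Δ(k) < 0 if and only if k > (2γ/(δ(1+δ)β))^{1/(2+δ)}, and Δ(k) > 0 for all 0 < k < (2γ/(δ(1+δ)β))^{1/(2+δ)}. -/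
/-- For the Ostrovsky–fKdV equation (symbol `m(k) = 1 − k^δ`, `δ > 1/2`) with
`γ > 0`, `β > 0`, the modulational instability index
`Δ(k) = (β(2^δ−1)k^δ + 3γ/(4k²))·(−βδ(1+δ)k^(δ−1) + 2γ/k³)` is negative iff
`k > (2γ/(δ(1+δ)β))^(1/(2+δ))`, and positive below that threshold. -/
theorem stmt_5 (γ β δ : ℝ) (hγ : 0 < γ) (hβ : 0 < β) (hδ : 1 / 2 < δ) :
    ∀ k : ℝ, 0 < k →
      (((β * ((2 : ℝ) ^ δ - 1) * k ^ δ + 3 * γ / (4 * k ^ 2)) *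
          (-(β * δ * (1 + δ)) * k ^ (δ - 1) + 2 * γ / k ^ 3) < 0) ↔
        (2 * γ / (δ * (1 + δ) * β)) ^ (1 / (2 + δ)) < k) ∧
      (k < (2 * γ / (δ * (1 + δ) * β)) ^ (1 / (2 + δ)) →
        0 < (β * ((2 : ℝ) ^ δ - 1) * k ^ δ + 3 * γ / (4 * k ^ 2)) *
          (-(β * δ * (1 + δ)) * k ^ (δ - 1) + 2 * γ / k ^ 3)) := by
  intro k hk
  have hδ0 : 0 < δ := by linarith
  have hA : 0 < 2 * γ / (δ * (1 + δ) * β) := by positivity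
  have h2 : 0 < (2 : ℝ) ^ δ - 1 := sub_pos.2 (Real.one_lt_rpow one_lt_two hδ0)
  have hfirst : 0 < β * ((2 : ℝ) ^ δ - 1) * k ^ δ + 3 * γ / (4 * k ^ 2) := by positivity
  have hpow : k ^ (2 + δ) = k ^ (δ - 1) * k ^ 3 := by
    rw [← Real.rpow_natCast k 3, ← Real.rpow_add hk]
    congr 1
    push_cast
    ring
  have hsecond : -(β * δ * (1 + δ)) * k ^ (δ - 1) + 2 * γ / k ^ 3 =
      δ * (1 + δ) * β / k ^ 3 * (2 * γ / (δ * (1 + δ) * β) - k ^ (2 + δ)) := by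
    rw [hpow]
    field_simp
    ring
  have hscale : 0 < δ * (1 + δ) * β / k ^ 3 := by positivity
  have mul_neg_iff_right {a b : ℝ} (ha : 0 < a) : a * b < 0 ↔ b < 0 :=
    smul_neg_iff_of_pos_left ha
  rw [mul_neg_iff_right hfirst, mul_pos_iff_of_pos_left hfirst, hsecond,
    mul_neg_iff_right hscale, mul_pos_iff_of_pos_left hscale, sub_neg, sub_pos, one_div,
    Real.rpow_inv_lt_iff_of_pos hA.le hk.le (by linarith),
    Real.lt_rpow_inv_iff_of_pos hk.le hA.le (by linarith)]
  exact ⟨Iff.rfl, id⟩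
end

section
/- Fix γ > 0, β < 0 and δ > 1/2, and for k > 0 define Δ(k) = (β(2^δ − 1)k^δ + 3γ/(4k²)) · (−βδ(1+δ)k^{δ−1} + 2γ/k³) (the modulational instability index of the Ostrovsky–fKdV equation, corresponding to the symbol m(k) = 1 − k^δ for k > 0). Then Δ(k) < 0 if and only if k > (3γ/(4(2^δ − 1)|β|))^{1/(2+δ)}, and Δ(k) > 0 for all 0 < k < (3γ/(4(2^δ − 1)|β|))^{1/(2+δ)}. -/
/-- A product with a positive right factor is negative iff its left factor is. -/
theorem mul_neg_iff_neg_of_pos_right {x c : ℝ} (hc : 0 < c) : x * c < 0 ↔ x < 0 := by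
  simp [mul_neg_iff, hc, hc.not_gt]


/-- For the Ostrovsky–fKdV equation (symbol `m(k) = 1 − k^δ`, `δ > 1/2`) with
`γ > 0`, `β < 0`, the modulational instability index
`Δ(k) = (β(2^δ−1)k^δ + 3γ/(4k²))·(−βδ(1+δ)k^(δ−1) + 2γ/k³)` is negative iff
`k > (3γ/(4(2^δ−1)|β|))^(1/(2+δ))`, and positive below that threshold. -/
theorem stmt_6 (γ β δ : ℝ) (hγ : 0 < γ) (hβ : β < 0) (hδ : 1 / 2 < δ) :
    ∀ k : ℝ, 0 < k →
      (((β * ((2 : ℝ) ^ δ - 1) * k ^ δ + 3 * γ / (4 * k ^ 2)) *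
          (-(β * δ * (1 + δ)) * k ^ (δ - 1) + 2 * γ / k ^ 3) < 0) ↔
        (3 * γ / (4 * ((2 : ℝ) ^ δ - 1) * |β|)) ^ (1 / (2 + δ)) < k) ∧
      (k < (3 * γ / (4 * ((2 : ℝ) ^ δ - 1) * |β|)) ^ (1 / (2 + δ)) →
        0 < (β * ((2 : ℝ) ^ δ - 1) * k ^ δ + 3 * γ / (4 * k ^ 2)) *
          (-(β * δ * (1 + δ)) * k ^ (δ - 1) + 2 * γ / k ^ 3)) := by
  intro k hk
  have ha : 0 < (2 : ℝ) ^ δ - 1 :=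
    sub_pos.2 (Real.one_lt_rpow (by norm_num) (by linarith))
  rw [abs_of_neg hβ]
  set a := (2 : ℝ) ^ δ - 1
  have hb : 0 < -β := neg_pos.2 hβ
  have hC : 0 < 3 * γ / (4 * a * -β) := by positivity
  have hpow : k ^ (2 + δ) = k ^ 2 * k ^ δ := by
    rw [Real.rpow_add hk, Real.rpow_two]
  have hfactor : β * a * k ^ δ + 3 * γ / (4 * k ^ 2) =
      (3 * γ / (4 * a * -β) - k ^ (2 + δ)) * (a * -β / k ^ 2) := by
    rw [hpow]
    have hβ' := hβ.ne
    field_simp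
    ring
  have hscale : 0 < a * -β / k ^ 2 := by positivity
  have hsecond : 0 < -(β * δ * (1 + δ)) * k ^ (δ - 1) + 2 * γ / k ^ 3 := by
    have hδ₀ : 0 < δ := by linarith
    have hcoeff : -(β * δ * (1 + δ)) = -β * δ * (1 + δ) := by ring
    rw [hcoeff]
    positivity
  rw [hfactor, one_div, mul_neg_iff_neg_of_pos_right hsecond, mul_neg_iff_neg_of_pos_right hscale,
    mul_pos_iff_of_pos_right hsecond, mul_pos_iff_of_pos_right hscale, sub_neg, sub_pos,
    Real.rpow_inv_lt_iff_of_pos hC.le hk.le (by linarith),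
    Real.lt_rpow_inv_iff_of_pos hk.le hC.le (by linarith)]
  exact ⟨Iff.rfl, id⟩
end

section
/- Fix γ > 0 and β > 0, and let m(k) = k·coth(k) = k·cosh(k)/sinh(k) for k > 0. Then there exists a unique k_c > 0 satisfying k_c²·(2k_c·coth(2k_c) − k_c·coth(k_c)) = 3γ/(4β); moreover, the modulational instability index Δ(k) = (c_p(k) − c_p(2k))·c_g'(k) of the Ostrovsky–ILW equation satisfies Δ(k) > 0 for 0 < k < k_c and Δ(k) < 0 for k > k_c. -/
theorem two_mul_coth_two_mul_sub_coth {k : ℝ} (hk : 0 < k) :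
    2 * k * (Real.cosh (2 * k) / Real.sinh (2 * k)) - k * (Real.cosh k / Real.sinh k) =
      k * Real.tanh k := by
  have hs : Real.sinh k ≠ 0 := (Real.sinh_pos_iff.2 hk).ne'
  have hc : Real.cosh k ≠ 0 := (Real.cosh_pos k).ne'
  rw [Real.tanh_eq_sinh_div_cosh, Real.cosh_two_mul, Real.sinh_two_mul]
  field_simp
  ring

theorem hasDerivAt_coth {k : ℝ} (hk : 0 < k) :
    HasDerivAt (fun x : ℝ => Real.cosh x / Real.sinh x) (-1 / Real.sinh k ^ 2) k := by
  have hs : Real.sinh k ≠ 0 := (Real.sinh_pos_iff.2 hk).ne'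
  refine ((Real.hasDerivAt_cosh k).fun_div (Real.hasDerivAt_sinh k) hs).congr_deriv ?_
  congr 1
  linear_combination -Real.cosh_sq k

theorem hasDerivAt_mul_cosh_div_sinh {k : ℝ} (hk : 0 < k) :
    HasDerivAt (fun x : ℝ => x * Real.cosh x / Real.sinh x)
      (Real.cosh k / Real.sinh k - k / Real.sinh k ^ 2) k := by
  simp only [mul_div_assoc]
  refine ((hasDerivAt_id' k).fun_mul (hasDerivAt_coth hk)).congr_deriv ?_
  ring

theorem deriv_groupVelocity_pos {β γ k : ℝ} (hβ : 0 < β) (hγ : 0 < γ) (hk : 0 < k) :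
    0 < deriv (fun x : ℝ => β * (x * Real.cosh x / Real.sinh x +
      x * deriv (fun y : ℝ => y * Real.cosh y / Real.sinh y) x) - γ / x ^ 2) k := by
  have hs : 0 < Real.sinh k := Real.sinh_pos_iff.2 hk
  have hc : 1 < Real.cosh k := Real.one_lt_cosh.2 hk.ne'
  have heq : (fun x : ℝ => β * (x * Real.cosh x / Real.sinh x +
      x * deriv (fun y : ℝ => y * Real.cosh y / Real.sinh y) x) - γ / x ^ 2) =ᶠ[nhds k]
      fun x => β * (2 * (x * Real.cosh x / Real.sinh x) - x ^ 2 / Real.sinh x ^ 2) - γ / x ^ 2 := by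
    filter_upwards [lt_mem_nhds hk] with x hx
    rw [(hasDerivAt_mul_cosh_div_sinh hx).deriv]
    ring
  have hd := ((((hasDerivAt_mul_cosh_div_sinh hk).const_mul 2).fun_sub
    ((hasDerivAt_pow 2 k).fun_div ((Real.hasDerivAt_sinh k).fun_pow 2)
      (pow_ne_zero 2 hs.ne'))).const_mul β).fun_sub
    ((hasDerivAt_const k γ).fun_div (hasDerivAt_pow 2 k) (pow_ne_zero 2 hk.ne'))
  rw [heq.deriv_eq, hd.deriv]
  have hpos : 0 < Real.cosh k * (Real.sinh k ^ 2 + k ^ 2) - 2 * k * Real.sinh k := by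
    nlinarith [sq_nonneg (Real.sinh k - k), mul_pos hk hs,
      mul_pos (sub_pos.2 hc) (by positivity : 0 < Real.sinh k ^ 2 + k ^ 2)]
  have key : 0 < β * (2 / Real.sinh k ^ 3 *
      (Real.cosh k * (Real.sinh k ^ 2 + k ^ 2) - 2 * k * Real.sinh k)) + 2 * γ / k ^ 3 := by
    positivity
  convert key using 1
  field_simp
  push_cast
  ring

theorem strictMono_tanh : StrictMono Real.tanh := by
  intro a b hab
  rw [Real.tanh_eq_sinh_div_cosh, Real.tanh_eq_sinh_div_cosh,
    div_lt_div_iff₀ (Real.cosh_pos a) (Real.cosh_pos b)]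
  have h := Real.sinh_pos_iff.2 (sub_pos.2 hab)
  rw [Real.sinh_sub] at h
  linarith

theorem tanh_pos_of_pos {x : ℝ} (hx : 0 < x) : 0 < Real.tanh x :=
  Real.tanh_zero ▸ strictMono_tanh hx

theorem continuous_tanh_real : Continuous Real.tanh := by
  rw [funext Real.tanh_eq_sinh_div_cosh]
  exact Real.continuous_sinh.div Real.continuous_cosh fun x => (Real.cosh_pos x).ne'

theorem strictMonoOn_cube_mul_tanh :
    StrictMonoOn (fun k : ℝ => k ^ 3 * Real.tanh k) (Set.Ici 0) := by
  intro a ha b _ hab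
  have ha : 0 ≤ a := ha
  have hb : 0 < Real.tanh b := tanh_pos_of_pos (ha.trans_lt hab)
  have h : Real.tanh a ≤ Real.tanh b := strictMono_tanh.monotone hab.le
  have h3 : a ^ 3 < b ^ 3 := pow_lt_pow_left₀ hab ha (by norm_num)
  exact (mul_le_mul_of_nonneg_left h (by positivity)).trans_lt (mul_lt_mul_of_pos_right h3 hb)

theorem exists_cube_mul_tanh_eq {T : ℝ} (hT : 0 < T) : ∃ k : ℝ, 0 < k ∧ k ^ 3 * Real.tanh k = T := by
  have h1 : 0 < Real.tanh 1 := tanh_pos_of_pos one_pos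
  set K := max 1 (T / Real.tanh 1) with hK
  have hK1 : 1 ≤ K := le_max_left _ _
  have hKT : T ≤ K * Real.tanh 1 := (div_le_iff₀ h1).1 (le_max_right _ _)
  have hcont : Continuous fun k : ℝ => k ^ 3 * Real.tanh k :=
    (continuous_pow 3).mul continuous_tanh_real
  have hle : T ≤ K ^ 3 * Real.tanh K := hKT.trans <|
    mul_le_mul (le_self_pow₀ hK1 (by norm_num)) (strictMono_tanh.monotone hK1) h1.le
      (by positivity)
  obtain ⟨k, hk, hkT⟩ := intermediate_value_Icc (zero_le_one.trans hK1) hcont.continuousOn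
    (show T ∈ Set.Icc _ _ from ⟨by simpa using hT.le, hle⟩)
  refine ⟨k, hk.1.lt_of_ne ?_, hkT⟩
  rintro rfl
  simp at hkT
  exact hT.ne hkT


/-- For the Ostrovsky–ILW equation (symbol `m(k) = k·coth(k)`) with `γ > 0`, `β > 0`:
there is a unique `k_c > 0` with `k_c²·(2k_c·coth(2k_c) − k_c·coth(k_c)) = 3γ/(4β)`,
and the modulational instability index `Δ(k) = (c_p(k) − c_p(2k))·c_g'(k)` satisfies
`Δ(k) > 0` for `0 < k < k_c` and `Δ(k) < 0` for `k > k_c`. -/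
theorem stmt_7 (γ β : ℝ) (hγ : 0 < γ) (hβ : 0 < β) :
    let m : ℝ → ℝ := fun k => k * Real.cosh k / Real.sinh k
    let cp : ℝ → ℝ := fun k => β * m k + γ / k ^ 2
    let cg : ℝ → ℝ := fun k => β * (m k + k * deriv m k) - γ / k ^ 2
    let Δ : ℝ → ℝ := fun k => (cp k - cp (2 * k)) * deriv cg k
    ∃ kc : ℝ, 0 < kc ∧
      kc ^ 2 * (2 * kc * (Real.cosh (2 * kc) / Real.sinh (2 * kc)) -
        kc * (Real.cosh kc / Real.sinh kc)) = 3 * γ / (4 * β) ∧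
      (∀ k : ℝ, 0 < k →
        k ^ 2 * (2 * k * (Real.cosh (2 * k) / Real.sinh (2 * k)) -
          k * (Real.cosh k / Real.sinh k)) = 3 * γ / (4 * β) → k = kc) ∧
      (∀ k : ℝ, 0 < k → k < kc → 0 < Δ k) ∧
      (∀ k : ℝ, kc < k → Δ k < 0) := by
  intro m cp cg Δ
  obtain ⟨kc, hkc, hT⟩ := exists_cube_mul_tanh_eq (by positivity : 0 < 3 * γ / (4 * β))
  have hF {k : ℝ} (hk : 0 < k) : k ^ 2 * (2 * k * (Real.cosh (2 * k) / Real.sinh (2 * k)) -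
      k * (Real.cosh k / Real.sinh k)) = k ^ 3 * Real.tanh k := by
    rw [two_mul_coth_two_mul_sub_coth hk]
    ring
  have hcp {k : ℝ} (hk : 0 < k) :
      cp k - cp (2 * k) = β / k ^ 2 * (kc ^ 3 * Real.tanh kc - k ^ 3 * Real.tanh k) := by
    rw [hT, ← hF hk]
    simp only [cp, m]
    field_simp
    ring
  have hcg {k : ℝ} (hk : 0 < k) : 0 < deriv cg k := deriv_groupVelocity_pos hβ hγ hk
  refine ⟨kc, hkc, (hF hkc).trans hT, fun k hk h => ?_, fun k hk h => ?_, fun k h => ?_⟩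
  · exact strictMonoOn_cube_mul_tanh.injOn hk.le hkc.le (((hF hk).symm.trans h).trans hT.symm)
  · have hlt := strictMonoOn_cube_mul_tanh hk.le hkc.le h
    refine mul_pos ?_ (hcg hk)
    rw [hcp hk]
    exact mul_pos (by positivity) (sub_pos.2 hlt)
  · have hk : 0 < k := hkc.trans h
    have hlt := strictMonoOn_cube_mul_tanh hkc.le hk.le h
    refine mul_neg_of_neg_of_pos ?_ (hcg hk)
    rw [hcp hk]
    exact mul_neg_of_pos_of_neg (by positivity) (sub_neg.2 hlt)
end

section
/- The function k ↦ √(tanh(k)/k) is strictly decreasing on (0, ∞). In particular, for every k > 0 and every integer n ≥ 2 one has √(tanh(n·k)/(n·k)) ≠ √(tanh(k)/k), so the Whitham symbol m(k) = √(tanh(k)/k) satisfies the non-resonance hypothesis (H3). -/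
/-- The derivative of `tanh x / x`, written as a single fraction. -/
theorem hasDerivAt_tanh_div_self {x : ℝ} (hx : x ≠ 0) :
    HasDerivAt (fun y : ℝ => Real.tanh y / y)
      ((x - Real.sinh x * Real.cosh x) / (x * Real.cosh x) ^ 2) x := by
  have hc : Real.cosh x ≠ 0 := (Real.cosh_pos x).ne'
  have h := ((Real.hasDerivAt_sinh x).div (Real.hasDerivAt_cosh x) hc).div (hasDerivAt_id x) hx
  have heq : (fun y : ℝ => Real.tanh y / y) = Real.sinh / Real.cosh / id := by
    funext y
    simp [Real.tanh_eq_sinh_div_cosh]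
  rw [heq]
  refine h.congr_deriv ?_
  simp only [Pi.div_apply, id]
  field_simp
  linear_combination x * Real.cosh_sq x

theorem self_lt_sinh_mul_cosh {x : ℝ} (hx : 0 < x) : x < Real.sinh x * Real.cosh x :=
  (Real.self_lt_sinh_iff.2 hx).trans_le
    (le_mul_of_one_le_right (Real.sinh_pos_iff.2 hx).le (Real.one_le_cosh x))

theorem strictAntiOn_tanh_div_self :
    StrictAntiOn (fun x : ℝ => Real.tanh x / x) (Set.Ioi 0) := by
  refine strictAntiOn_of_deriv_neg (convex_Ioi 0)
    (fun x hx => (hasDerivAt_tanh_div_self (ne_of_gt hx)).continuousAt.continuousWithinAt)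
    fun x hx => ?_
  rw [interior_Ioi, Set.mem_Ioi] at hx
  rw [(hasDerivAt_tanh_div_self hx.ne').deriv]
  have hc := Real.cosh_pos x
  exact div_neg_of_neg_of_pos (sub_neg.2 (self_lt_sinh_mul_cosh hx)) (by positivity)

theorem strictAntiOn_sqrt_tanh_div_self :
    StrictAntiOn (fun x : ℝ => Real.sqrt (Real.tanh x / x)) (Set.Ioi 0) := by
  intro x hx y hy hxy
  have hy' : 0 < y := hy
  have hpos : 0 ≤ Real.tanh y / y := by
    rw [Real.tanh_eq_sinh_div_cosh]
    have := Real.sinh_pos_iff.2 hy'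
    have := Real.cosh_pos y
    positivity
  exact Real.sqrt_lt_sqrt hpos (strictAntiOn_tanh_div_self hx hy hxy)

/-- The Whitham symbol `m(k) = √(tanh(k)/k)` is strictly decreasing on `(0,∞)`;
in particular, for every `k > 0` and integer `n ≥ 2`,
`√(tanh(n·k)/(n·k)) ≠ √(tanh(k)/k)`, i.e. the non-resonance hypothesis (H3) holds. -/
theorem stmt_12 :
    StrictAntiOn (fun k : ℝ => Real.sqrt (Real.tanh k / k)) (Set.Ioi (0 : ℝ)) ∧
    ∀ k : ℝ, 0 < k → ∀ n : ℤ, 2 ≤ n →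
      Real.sqrt (Real.tanh ((n : ℝ) * k) / ((n : ℝ) * k)) ≠
        Real.sqrt (Real.tanh k / k) := by
  refine ⟨strictAntiOn_sqrt_tanh_div_self, fun k hk n hn => ?_⟩
  have hn' : (2 : ℝ) ≤ n := by exact_mod_cast hn
  have hlt : k < n * k := by nlinarith
  exact (strictAntiOn_sqrt_tanh_div_self hk (hk.trans hlt) hlt).ne
end

section
/- Fix γ > 0, β > 0 and T ≥ 0 with T ≠ 1/3, and for k > 0 define Δ_T(k) = (3β(1−3T)k² + 3γ/(4k²)) · (−6β(1−3T)k + 2γ/k³) (the modulational instability index of the Ostrovsky equation with surface tension, corresponding to the symbol m(k,T) = 1 − (1−3T)k²). If T < 1/3, then Δ_T(k) < 0 if and only if k > (γ/(3β(1−3T)))^{1/4}, with Δ_T(k) > 0 for 0 < k below this threshold. If T > 1/3, then Δ_T(k) < 0 if and only if k > (γ/(4β(3T−1)))^{1/4}, with Δ_T(k) > 0 for 0 < k below this threshold. -/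
/-- A product of a positive factor with `x - k ^ 4` changes sign, as `k > 0` grows, exactly at the
fourth root of `x`. -/
theorem sign_change_at_fourth_root {x k p d : ℝ} (hx : 0 ≤ x) (hk : 0 < k) (hp : 0 < p)
    (hd : d = p * (x - k ^ 4)) :
    (d < 0 ↔ x ^ ((1 : ℝ) / 4) < k) ∧ (k < x ^ ((1 : ℝ) / 4) → 0 < d) := by
  have hr : 0 ≤ x ^ ((1 : ℝ) / 4) := Real.rpow_nonneg hx _
  have hr4 : (x ^ ((1 : ℝ) / 4)) ^ 4 = x := by
    rw [← Real.rpow_natCast, ← Real.rpow_mul hx]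
    norm_num
  subst hd
  constructor
  · rw [← smul_eq_mul, smul_neg_iff_of_pos_left hp, sub_neg,
      ← pow_lt_pow_iff_left₀ hr hk.le four_ne_zero, hr4]
  · intro h
    have h4 := pow_lt_pow_left₀ h hk.le four_ne_zero
    rw [hr4] at h4
    exact mul_pos hp (sub_pos.2 h4)

/-- Ostrovsky equation with surface tension `T ≥ 0`, `T ≠ 1/3`, `γ > 0`, `β > 0`
(symbol `m(k,T) = 1 − (1−3T)k²`). The index
`Δ_T(k) = (3β(1−3T)k² + 3γ/(4k²))·(−6β(1−3T)k + 2γ/k³)` satisfies: if `T < 1/3`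
then `Δ_T(k) < 0 ↔ k > (γ/(3β(1−3T)))^(1/4)` with `Δ_T(k) > 0` below the threshold;
if `T > 1/3` then `Δ_T(k) < 0 ↔ k > (γ/(4β(3T−1)))^(1/4)` with `Δ_T(k) > 0` below
the threshold. -/
theorem stmt_13 (γ β T : ℝ) (hγ : 0 < γ) (hβ : 0 < β) (hT : 0 ≤ T) (hT3 : T ≠ 1 / 3) :
    let Δ : ℝ → ℝ := fun k =>
      (3 * β * (1 - 3 * T) * k ^ 2 + 3 * γ / (4 * k ^ 2)) *
        (-6 * β * (1 - 3 * T) * k + 2 * γ / k ^ 3)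
    (T < 1 / 3 →
      ∀ k : ℝ, 0 < k →
        ((Δ k < 0 ↔ (γ / (3 * β * (1 - 3 * T))) ^ ((1 : ℝ) / 4) < k) ∧
          (k < (γ / (3 * β * (1 - 3 * T))) ^ ((1 : ℝ) / 4) → 0 < Δ k))) ∧
    (1 / 3 < T →
      ∀ k : ℝ, 0 < k →
        ((Δ k < 0 ↔ (γ / (4 * β * (3 * T - 1))) ^ ((1 : ℝ) / 4) < k) ∧
          (k < (γ / (4 * β * (3 * T - 1))) ^ ((1 : ℝ) / 4) → 0 < Δ k))) := by
  intro Δ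
  refine ⟨fun h k hk => ?_, fun h k hk => ?_⟩
  · have ha : 0 < 1 - 3 * T := by linarith
    refine sign_change_at_fourth_root (by positivity) hk
      (p := 9 * β * (1 - 3 * T) * (4 * β * (1 - 3 * T) * k ^ 4 + γ) / (2 * k ^ 5))
      (by positivity) ?_
    simp only [Δ]
    field_simp
    ring
  · have ha : 0 < 3 * T - 1 := by linarith
    refine sign_change_at_fourth_root (by positivity) hk
      (p := 6 * β * (3 * T - 1) * (3 * β * (3 * T - 1) * k ^ 4 + γ) / k ^ 5)
      (by positivity) ?_
    simp only [Δ]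
    field_simp
    ring
end

section
/- Fix γ > 0, β < 0 and T ≥ 0 with T ≠ 1/3, and for k > 0 define Δ_T(k) = (3β(1−3T)k² + 3γ/(4k²)) · (−6β(1−3T)k + 2γ/k³) (the modulational instability index of the Ostrovsky equation with surface tension, corresponding to the symbol m(k,T) = 1 − (1−3T)k²). If T < 1/3, then Δ_T(k) < 0 if and only if k > (γ/(4|β|(1−3T)))^{1/4}, with Δ_T(k) > 0 for 0 < k below this threshold. If T > 1/3, then Δ_T(k) < 0 if and only if k > (γ/(3|β|(3T−1)))^{1/4}, with Δ_T(k) > 0 for 0 < k below this threshold. -/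
theorem rpow_one_div_four_lt_iff {c k : ℝ} (hc : 0 ≤ c) (hk : 0 < k) :
    c ^ ((1 : ℝ) / 4) < k ↔ c < k ^ 4 := by
  rw [one_div, Real.rpow_inv_lt_iff_of_pos hc hk.le (by norm_num)]
  norm_cast

theorem lt_rpow_one_div_four_iff {c k : ℝ} (hc : 0 ≤ c) (hk : 0 < k) :
    k < c ^ ((1 : ℝ) / 4) ↔ k ^ 4 < c := by
  rw [one_div, Real.lt_rpow_inv_iff_of_pos hk.le hc (by norm_num)]
  norm_cast

/-- If `f` is a positive multiple of `γ - b * k ^ 4`, its sign changes exactly once, at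
`k = (γ / b) ^ (1 / 4)`. -/
theorem sign_change_at_fourth_root_s14 {γ b k f p : ℝ} (hγ : 0 < γ) (hb : 0 < b) (hk : 0 < k)
    (hp : 0 < p) (hf : f = p * (γ - b * k ^ 4)) :
    (f < 0 ↔ (γ / b) ^ ((1 : ℝ) / 4) < k) ∧ (k < (γ / b) ^ ((1 : ℝ) / 4) → 0 < f) := by
  have hc : 0 ≤ γ / b := (div_pos hγ hb).le
  have hneg : p * (γ - b * k ^ 4) < 0 ↔ γ - b * k ^ 4 < 0 := smul_neg_iff_of_pos_left hp
  rw [rpow_one_div_four_lt_iff hc hk, lt_rpow_one_div_four_iff hc hk, div_lt_iff₀ hb,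
    lt_div_iff₀ hb, hf, hneg, mul_pos_iff_of_pos_left hp, sub_neg,
    sub_pos, mul_comm b]
  exact ⟨Iff.rfl, id⟩

/-- Ostrovsky equation with surface tension `T ≥ 0`, `T ≠ 1/3`, `γ > 0`, `β < 0`
(symbol `m(k,T) = 1 − (1−3T)k²`). The index
`Δ_T(k) = (3β(1−3T)k² + 3γ/(4k²))·(−6β(1−3T)k + 2γ/k³)` satisfies: if `T < 1/3`
then `Δ_T(k) < 0 ↔ k > (γ/(4|β|(1−3T)))^(1/4)` with `Δ_T(k) > 0` below the
threshold; if `T > 1/3` then `Δ_T(k) < 0 ↔ k > (γ/(3|β|(3T−1)))^(1/4)` with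
`Δ_T(k) > 0` below the threshold. -/
theorem stmt_14 (γ β T : ℝ) (hγ : 0 < γ) (hβ : β < 0) (hT : 0 ≤ T) (hT3 : T ≠ 1 / 3) :
    let Δ : ℝ → ℝ := fun k =>
      (3 * β * (1 - 3 * T) * k ^ 2 + 3 * γ / (4 * k ^ 2)) *
        (-6 * β * (1 - 3 * T) * k + 2 * γ / k ^ 3)
    (T < 1 / 3 →
      ∀ k : ℝ, 0 < k →
        ((Δ k < 0 ↔ (γ / (4 * |β| * (1 - 3 * T))) ^ ((1 : ℝ) / 4) < k) ∧
          (k < (γ / (4 * |β| * (1 - 3 * T))) ^ ((1 : ℝ) / 4) → 0 < Δ k))) ∧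
    (1 / 3 < T →
      ∀ k : ℝ, 0 < k →
        ((Δ k < 0 ↔ (γ / (3 * |β| * (3 * T - 1))) ^ ((1 : ℝ) / 4) < k) ∧
          (k < (γ / (3 * |β| * (3 * T - 1))) ^ ((1 : ℝ) / 4) → 0 < Δ k))) := by
  intro Δ
  have hfac (k : ℝ) (hk : 0 < k) : Δ k = 3 / (2 * k ^ 5) *
      ((γ + 4 * (β * (1 - 3 * T)) * k ^ 4) * (γ - 3 * (β * (1 - 3 * T)) * k ^ 4)) := by
    simp only [Δ]
    field_simp
    ring
  rw [abs_of_neg hβ]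
  refine ⟨fun h k hk => ?_, fun h k hk => ?_⟩
  · have ha : 0 < -β * (1 - 3 * T) := mul_pos (by linarith) (by linarith)
    have hq : 0 < γ + 3 * (-β * (1 - 3 * T)) * k ^ 4 := by positivity
    refine sign_change_at_fourth_root_s14 hγ (by linarith) hk
      (p := 3 / (2 * k ^ 5) * (γ + 3 * (-β * (1 - 3 * T)) * k ^ 4)) (by positivity) ?_
    rw [hfac k hk]
    ring
  · have ha : 0 < -β * (3 * T - 1) := mul_pos (by linarith) (by linarith)
    have hq : 0 < γ + 4 * (-β * (3 * T - 1)) * k ^ 4 := by positivity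
    refine sign_change_at_fourth_root_s14 hγ (by linarith) hk
      (p := 3 / (2 * k ^ 5) * (γ + 4 * (-β * (3 * T - 1)) * k ^ 4)) (by positivity) ?_
    rw [hfac k hk]
    ring
end

section
/- Let T > 1/3. Then the function k ↦ √((tanh(k)/k)·(1 + T·k²)) is strictly increasing on (0, ∞). -/
/-- A function vanishing at `0` with positive derivative on `(0,∞)` is positive there. -/
theorem pos_of_hasDerivAt_pos {f f' : ℝ → ℝ} (hf : ∀ x, HasDerivAt f (f' x) x) (h0 : f 0 = 0)
    (hf' : ∀ x, 0 < x → 0 < f' x) (x : ℝ) (hx : 0 < x) : 0 < f x := by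
  have hmono : StrictMonoOn f (Set.Ici 0) := by
    refine strictMonoOn_of_deriv_pos (convex_Ici 0)
      (fun y _ => (hf y).continuousAt.continuousWithinAt) fun y hy => ?_
    rw [interior_Ici] at hy
    rw [(hf y).deriv]
    exact hf' y hy
  simpa [h0] using hmono Set.self_mem_Ici hx.le hx

theorem cubic_add_sinh_mul_cosh_pos (x : ℝ) (hx : 0 < x) :
    0 < x ^ 3 + 3 * x + Real.sinh x * Real.cosh x * (x ^ 2 - 3) := by
  have hS (x : ℝ) : HasDerivAt (fun x => Real.sinh (2 * x)) (2 * Real.cosh (2 * x)) x := by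
    simpa [mul_comm] using ((hasDerivAt_id x).const_mul 2).sinh
  have hC (x : ℝ) : HasDerivAt (fun x => Real.cosh (2 * x)) (2 * Real.sinh (2 * x)) x := by
    simpa [mul_comm] using ((hasDerivAt_id x).const_mul 2).cosh
  have hI (x : ℝ) : HasDerivAt (fun x : ℝ => x) 1 x := hasDerivAt_id' x
  have h4 (x : ℝ) (hx : 0 < x) :
      0 < 8 * x ^ 2 * Real.sinh (2 * x) + 32 * x * Real.cosh (2 * x) := by
    have := Real.sinh_pos_iff.2 (by positivity : 0 < 2 * x)
    have := Real.cosh_pos (2 * x)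
    positivity
  have h3 := pos_of_hasDerivAt_pos
    (f := fun x => 6 + Real.cosh (2 * x) * (4 * x ^ 2 - 6) + 12 * (x * Real.sinh (2 * x)))
    (fun x => by
      convert! (((hC x).mul ((((hI x).pow 2).const_mul 4).sub_const 6)).const_add 6).add
        (((hI x).mul (hS x)).const_mul 12) using 1
      simp
      ring) (by simp) h4
  have h2 := pos_of_hasDerivAt_pos
    (f := fun x => 6 * x + Real.sinh (2 * x) * (2 * x ^ 2 - 5) + 4 * (x * Real.cosh (2 * x)))
    (fun x => by
      convert! (((hI x).const_mul 6).add
        ((hS x).mul ((((hI x).pow 2).const_mul 2).sub_const 5))).add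
        (((hI x).mul (hC x)).const_mul 4) using 1
      simp
      ring) (by simp) h3
  have h1 := pos_of_hasDerivAt_pos
    (f := fun x => 3 * x ^ 2 + 3 + Real.cosh (2 * x) * (x ^ 2 - 3) + x * Real.sinh (2 * x))
    (fun x => by
      convert! (((((hI x).pow 2).const_mul 3).add_const 3).add
        ((hC x).mul (((hI x).pow 2).sub_const 3))).add ((hI x).mul (hS x)) using 1
      simp
      ring) (by simp) h2
  have h := pos_of_hasDerivAt_pos
    (f := fun x => x ^ 3 + 3 * x + Real.sinh (2 * x) * (x ^ 2 - 3) / 2)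
    (fun x => by
      convert! (((hI x).pow 3).add ((hI x).const_mul 3)).add
        (((hS x).mul (((hI x).pow 2).sub_const 3)).div_const 2) using 1
      simp
      ring) (by simp) h1 x hx
  rw [Real.sinh_two_mul] at h
  linarith

theorem strictMonoOn_tanh_div_mul {T : ℝ} (hT : 1 / 3 < T) :
    StrictMonoOn (fun k : ℝ => Real.tanh k / k * (1 + T * k ^ 2)) (Set.Ioi 0) := by
  have hder (x : ℝ) (hx : 0 < x) :
      HasDerivAt (fun k : ℝ => Real.tanh k / k * (1 + T * k ^ 2))
        ((x * (1 + T * x ^ 2) + Real.sinh x * Real.cosh x * (T * x ^ 2 - 1)) /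
          (x * Real.cosh x) ^ 2) x := by
    have hc := (Real.cosh_pos x).ne'
    have hx0 := hx.ne'
    simp only [Real.tanh_eq_sinh_div_cosh]
    convert! (((Real.hasDerivAt_sinh x).div (Real.hasDerivAt_cosh x) hc).div
      (hasDerivAt_id' x) hx0).mul ((((hasDerivAt_id' x).pow 2).const_mul T).const_add 1) using 1
    simp only [Pi.div_apply, Pi.pow_apply]
    field_simp
    simp only [Real.cosh_sq x]
    push_cast
    ring
  refine strictMonoOn_of_deriv_pos (convex_Ioi 0)
    (fun y hy => (hder y hy).continuousAt.continuousWithinAt) fun x hx => ?_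
  rw [interior_Ioi] at hx
  replace hx : 0 < x := hx
  rw [(hder x hx).deriv]
  have hs := Real.sinh_pos_iff.2 hx
  have hc := Real.cosh_pos x
  have hT' : 0 < T - 1 / 3 := sub_pos.2 hT
  have hrest : 0 < (T - 1 / 3) * (x ^ 3 + Real.sinh x * Real.cosh x * x ^ 2) := by positivity
  have := cubic_add_sinh_mul_cosh_pos x hx
  exact div_pos (by linarith) (by positivity)

/-- Strong surface tension `T > 1/3`: the Ostrovsky–Whitham symbol
`m(k,T) = √((tanh(k)/k)·(1 + T·k²))` is strictly increasing on `(0,∞)`. -/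
theorem stmt_17 (T : ℝ) (hT : 1 / 3 < T) :
    StrictMonoOn (fun k : ℝ => Real.sqrt ((Real.tanh k / k) * (1 + T * k ^ 2)))
      (Set.Ioi (0 : ℝ)) := by
  intro a ha b hb hab
  refine Real.sqrt_lt_sqrt ?_ (strictMonoOn_tanh_div_mul hT ha hb hab)
  replace ha : 0 < a := ha
  have hs := Real.sinh_pos_iff.2 ha
  have hc := Real.cosh_pos a
  have hT0 : 0 < T := by linarith
  rw [Real.tanh_eq_sinh_div_cosh]
  positivity
end

section
/- Let 0 < T < 1/3. Then there exists a unique k*(T) > 0 such that the function k ↦ √((tanh(k)/k)·(1 + T·k²)) is strictly decreasing on (0, k*(T)) and strictly increasing on (k*(T), ∞). -/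
open Real Set

lemma self_add_cube_div_six_lt_sinh {x : ℝ} (hx : 0 < x) : x + x ^ 3 / 6 < sinh x := by
  have hcosh (y : ℝ) : 1 + y ^ 2 / 2 ≤ cosh y := by
    have hs : (y / 2) ^ 2 ≤ sinh (y / 2) ^ 2 := by
      rw [sq_le_sq, abs_sinh]
      exact self_le_sinh_iff.2 (abs_nonneg _)
    have h := cosh_two_mul (y / 2)
    rw [cosh_sq, mul_div_cancel₀ y two_ne_zero] at h
    linarith
  have hd (y : ℝ) : HasDerivAt (fun y => sinh y - (y + y ^ 3 / 6))
      (cosh y - (1 + 3 * y ^ 2 / 6)) y := by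
    refine (hasDerivAt_sinh y).sub ((hasDerivAt_id y).add ?_)
    simpa using ((hasDerivAt_pow 3 y).div_const 6)
  have hmono : StrictMonoOn (fun y => sinh y - (y + y ^ 3 / 6)) (Ici 0) := by
    refine strictMonoOn_of_deriv_pos (convex_Ici 0)
      (fun y _ => (hd y).continuousAt.continuousWithinAt) fun y hy => ?_
    rw [interior_Ici] at hy
    have hy : 0 < y := hy
    have hs : (y / 2) ^ 2 < sinh (y / 2) ^ 2 :=
      pow_lt_pow_left₀ (self_lt_sinh_iff.2 (half_pos hy)) (half_pos hy).le two_ne_zero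
    have h := cosh_two_mul (y / 2)
    rw [cosh_sq, mul_div_cancel₀ y two_ne_zero] at h
    rw [(hd y).deriv]
    linarith
  have h := hmono self_mem_Ici hx.le hx
  simp only [sinh_zero] at h
  linarith

lemma sinh_le_self_mul_cosh {x : ℝ} (hx : 0 ≤ x) : sinh x ≤ x * cosh x := by
  have hd (y : ℝ) : HasDerivAt (fun y => y * cosh y - sinh y) (y * sinh y) y := by
    refine (((hasDerivAt_id y).mul (hasDerivAt_cosh y)).sub (hasDerivAt_sinh y)).congr_deriv ?_
    simp
  have hmono : MonotoneOn (fun y => y * cosh y - sinh y) (Ici 0) := by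
    refine monotoneOn_of_deriv_nonneg (convex_Ici 0)
      (fun y _ => (hd y).continuousAt.continuousWithinAt)
      (fun y _ => (hd y).differentiableAt.differentiableWithinAt) fun y hy => ?_
    rw [interior_Ici] at hy
    rw [(hd y).deriv]
    exact mul_nonneg (le_of_lt hy) (sinh_nonneg_iff.2 (le_of_lt hy))
  have h := hmono self_mem_Ici hx hx
  simp only [sinh_zero] at h
  linarith

lemma self_sub_cube_div_three_mul_cosh_le_sinh {x : ℝ} (hx : 0 ≤ x) :
    (x - x ^ 3 / 3) * cosh x ≤ sinh x := by
  have hd (y : ℝ) : HasDerivAt (fun y => sinh y - (y - y ^ 3 / 3) * cosh y)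
      (cosh y - ((1 - 3 * y ^ 2 / 3) * cosh y + (y - y ^ 3 / 3) * sinh y)) y := by
    refine (hasDerivAt_sinh y).sub (HasDerivAt.mul ?_ (hasDerivAt_cosh y))
    refine (hasDerivAt_id y).sub ?_
    simpa using ((hasDerivAt_pow 3 y).div_const 3)
  have hmono : MonotoneOn (fun y => sinh y - (y - y ^ 3 / 3) * cosh y) (Ici 0) := by
    refine monotoneOn_of_deriv_nonneg (convex_Ici 0)
      (fun y _ => (hd y).continuousAt.continuousWithinAt)
      (fun y _ => (hd y).differentiableAt.differentiableWithinAt) fun y hy => ?_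
    rw [interior_Ici] at hy
    have hy : 0 < y := hy
    rw [(hd y).deriv]
    have h1 := mul_nonneg hy.le (sub_nonneg.2 (sinh_le_self_mul_cosh hy.le))
    have h2 := mul_nonneg (pow_nonneg hy.le 3) (sinh_nonneg_iff.2 hy.le)
    linarith
  have h := hmono self_mem_Ici hx hx
  simp only [sinh_zero] at h
  linarith

/-- The hyperbolic Wilker inequality `2 < (sinh x / x) ^ 2 + tanh x / x`, cleared of
denominators. -/
lemma hyperbolic_wilker {x : ℝ} (hx : 0 < x) :
    2 * x ^ 2 * cosh x < sinh x ^ 2 * cosh x + x * sinh x := by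
  have h1 : (x + x ^ 3 / 6) ^ 2 < sinh x ^ 2 :=
    pow_lt_pow_left₀ (self_add_cube_div_six_lt_sinh hx) (by positivity) two_ne_zero
  have h2 := mul_le_mul_of_nonneg_left (self_sub_cube_div_three_mul_cosh_le_sinh hx.le) hx.le
  have h3 := mul_lt_mul_of_pos_right h1 (cosh_pos x)
  have h4 : 0 < x ^ 6 * cosh x := mul_pos (pow_pos hx 6) (cosh_pos x)
  linarith

/-- The value of the surface tension for which `k` is a critical point of the symbol. -/
noncomputable def criticalTension (k : ℝ) : ℝ :=
  (sinh (2 * k) - 2 * k) / (k ^ 2 * (sinh (2 * k) + 2 * k))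

lemma sq_mul_sinh_add_pos {k : ℝ} (hk : 0 < k) : 0 < k ^ 2 * (sinh (2 * k) + 2 * k) := by
  have : 0 < sinh (2 * k) := sinh_pos_iff.2 (by positivity)
  positivity

lemma hasDerivAt_sinh_two_mul (k : ℝ) :
    HasDerivAt (fun k => sinh (2 * k)) (cosh (2 * k) * 2) k := by
  simpa using ((hasDerivAt_id k).const_mul 2).sinh

lemma hasDerivAt_criticalTension {k : ℝ} (hk : 0 < k) :
    HasDerivAt criticalTension
      (-(8 * k * cosh k * (sinh k ^ 2 * cosh k + k * sinh k - 2 * k ^ 2 * cosh k)) /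
        (k ^ 2 * (sinh (2 * k) + 2 * k)) ^ 2) k := by
  have hlin : HasDerivAt (fun k : ℝ => 2 * k) 2 k := by
    simpa using (hasDerivAt_id k).const_mul 2
  have h := ((hasDerivAt_sinh_two_mul k).sub hlin).div
    ((hasDerivAt_pow 2 k).mul ((hasDerivAt_sinh_two_mul k).add hlin)) (sq_mul_sinh_add_pos hk).ne'
  refine h.congr_deriv ?_
  simp only [Pi.add_apply, Pi.sub_apply, Pi.mul_apply]
  congr 1
  have hc : cosh (2 * k) = 2 * cosh k ^ 2 - 1 := by
    rw [cosh_two_mul, sinh_sq]; ring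
  rw [hc, sinh_two_mul]
  push_cast
  ring

lemma strictAntiOn_criticalTension : StrictAntiOn criticalTension (Ioi 0) := by
  refine strictAntiOn_of_deriv_neg (convex_Ioi 0)
    (fun k hk => (hasDerivAt_criticalTension hk).continuousAt.continuousWithinAt) fun k hk => ?_
  rw [interior_Ioi] at hk
  have hk' : 0 < k := hk
  rw [(hasDerivAt_criticalTension hk).deriv]
  have h := sub_pos.2 (hyperbolic_wilker hk')
  have := cosh_pos k
  have := sq_mul_sinh_add_pos hk'
  rw [neg_div]
  exact neg_neg_of_pos (by positivity)

lemma inv_three_add_sq_lt_criticalTension {k : ℝ} (hk : 0 < k) :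
    1 / (3 + k ^ 2) < criticalTension k := by
  rw [criticalTension, div_lt_div_iff₀ (by positivity) (sq_mul_sinh_add_pos hk)]
  have h := self_add_cube_div_six_lt_sinh (show 0 < 2 * k by positivity)
  linarith

lemma criticalTension_lt_inv_sq {k : ℝ} (hk : 0 < k) : criticalTension k < 1 / k ^ 2 := by
  rw [criticalTension, div_lt_div_iff₀ (sq_mul_sinh_add_pos hk) (by positivity)]
  have : 0 < k ^ 3 := by positivity
  linarith

lemma exists_criticalTension_eq {T : ℝ} (hT0 : 0 < T) (hT : T < 1 / 3) :
    ∃ k, 0 < k ∧ criticalTension k = T := by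
  have hinv : 3 < 1 / T := by
    rw [lt_div_iff₀ hT0]; linarith
  have ha : 0 < √(1 / T - 3) := sqrt_pos.2 (by linarith)
  have hab : √(1 / T - 3) ≤ √(1 / T) := sqrt_le_sqrt (by linarith)
  have hTa : T ≤ criticalTension √(1 / T - 3) := by
    have h := inv_three_add_sq_lt_criticalTension ha
    rw [sq_sqrt (by linarith), add_sub_cancel, one_div_one_div] at h
    exact h.le
  have hTb : criticalTension √(1 / T) ≤ T := by
    have h := criticalTension_lt_inv_sq (ha.trans_le hab)
    rw [sq_sqrt (by linarith), one_div_one_div] at h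
    exact h.le
  obtain ⟨k, hk, hkT⟩ := intermediate_value_Icc' hab
    (fun k hk => (hasDerivAt_criticalTension
      (ha.trans_le hk.1)).continuousAt.continuousWithinAt) ⟨hTb, hTa⟩
  exact ⟨k, ha.trans_le hk.1, hkT⟩

lemma hasDerivAt_tanh_div_mul (T : ℝ) {k : ℝ} (hk : 0 < k) :
    HasDerivAt (fun k => tanh k / k * (1 + T * k ^ 2))
      (k ^ 2 * (sinh (2 * k) + 2 * k) / (2 * (k * cosh k) ^ 2) * (T - criticalTension k)) k := by
  have hpoly : HasDerivAt (fun k : ℝ => 1 + T * k ^ 2) (T * (2 * k)) k := by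
    simpa using ((hasDerivAt_pow 2 k).const_mul T).const_add 1
  have hc := (cosh_pos k).ne'
  have h := ((hasDerivAt_sinh k).mul hpoly).div ((hasDerivAt_id k).mul (hasDerivAt_cosh k))
    (mul_ne_zero hk.ne' hc)
  have hfun : (fun k => tanh k / k * (1 + T * k ^ 2)) =
      (sinh * fun k => 1 + T * k ^ 2) / (id * cosh) := by
    ext y
    simp only [Pi.div_apply, Pi.mul_apply, id, tanh_eq_sinh_div_cosh, div_div]
    rw [div_mul_eq_mul_div, mul_comm (cosh y)]
  rw [hfun]
  refine h.congr_deriv ?_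
  have hD := (sq_mul_sinh_add_pos hk).ne'
  have hcT : k ^ 2 * (sinh (2 * k) + 2 * k) * (T - criticalTension k) =
      T * (k ^ 2 * (sinh (2 * k) + 2 * k)) - (sinh (2 * k) - 2 * k) := by
    rw [criticalTension, mul_sub, mul_div_cancel₀ _ hD]; ring
  rw [div_mul_eq_mul_div, hcT, sinh_two_mul]
  simp only [Pi.mul_apply, id]
  have hk0 := hk.ne'
  field_simp
  linear_combination k * (1 + T * k ^ 2) * cosh_sq k

/-- Weak surface tension `0 < T < 1/3`: there is a unique `k*(T) > 0` such that the
Ostrovsky–Whitham symbol `m(k,T) = √((tanh(k)/k)·(1 + T·k²))` is strictly decreasing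
on `(0, k*(T))` and strictly increasing on `(k*(T), ∞)`. -/
theorem stmt_18 (T : ℝ) (hT0 : 0 < T) (hT : T < 1 / 3) :
    ∃! ks : ℝ, 0 < ks ∧
      StrictAntiOn (fun k : ℝ => Real.sqrt ((Real.tanh k / k) * (1 + T * k ^ 2)))
        (Set.Ioo (0 : ℝ) ks) ∧
      StrictMonoOn (fun k : ℝ => Real.sqrt ((Real.tanh k / k) * (1 + T * k ^ 2)))
        (Set.Ioi ks) := by
  obtain ⟨ks, hks, rfl⟩ := exists_criticalTension_eq hT0 hT
  set T := criticalTension ks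
  have hpos {k : ℝ} (hk : 0 < k) :
      0 < k ^ 2 * (sinh (2 * k) + 2 * k) / (2 * (k * cosh k) ^ 2) := by
    have := sq_mul_sinh_add_pos hk
    have := cosh_pos k
    positivity
  have hnonneg {k : ℝ} (hk : 0 < k) : 0 ≤ tanh k / k * (1 + T * k ^ 2) := by
    have : 0 < sinh k := sinh_pos_iff.2 hk
    have := cosh_pos k
    rw [tanh_eq_sinh_div_cosh]
    positivity
  have hanti : StrictAntiOn (fun k => tanh k / k * (1 + T * k ^ 2)) (Ioo 0 ks) := by
    refine strictAntiOn_of_deriv_neg (convex_Ioo 0 ks)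
      (fun k hk => (hasDerivAt_tanh_div_mul T hk.1).continuousAt.continuousWithinAt) fun k hk => ?_
    rw [interior_Ioo] at hk
    rw [(hasDerivAt_tanh_div_mul T hk.1).deriv]
    exact mul_neg_of_pos_of_neg (hpos hk.1)
      (sub_neg.2 (strictAntiOn_criticalTension hk.1 hks hk.2))
  have hmono : StrictMonoOn (fun k => tanh k / k * (1 + T * k ^ 2)) (Ioi ks) := by
    refine strictMonoOn_of_deriv_pos (convex_Ioi ks)
      (fun k hk => (hasDerivAt_tanh_div_mul T (hks.trans hk)).continuousAt.continuousWithinAt)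
      fun k hk => ?_
    rw [interior_Ioi] at hk
    rw [(hasDerivAt_tanh_div_mul T (hks.trans hk)).deriv]
    exact mul_pos (hpos (hks.trans hk))
      (sub_pos.2 (strictAntiOn_criticalTension hks (hks.trans hk) hk))
  have not_both {f : ℝ → ℝ} {a b : ℝ} (ha : 0 < a) (hab : a < b) (hm : StrictMonoOn f (Ioi a))
      (hd : StrictAntiOn f (Ioo 0 b)) : False := by
    obtain ⟨c, hac, hcb⟩ := exists_between hab
    obtain ⟨d, hcd, hdb⟩ := exists_between hcb
    exact lt_asymm (hm hac (hac.trans hcd) hcd)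
      (hd ⟨ha.trans hac, hcb⟩ ⟨ha.trans (hac.trans hcd), hdb⟩ hcd)
  have hanti' : StrictAntiOn (fun k => √(tanh k / k * (1 + T * k ^ 2))) (Ioo 0 ks) :=
    fun a ha b hb hab => sqrt_lt_sqrt (hnonneg hb.1) (hanti ha hb hab)
  have hmono' : StrictMonoOn (fun k => √(tanh k / k * (1 + T * k ^ 2))) (Ioi ks) :=
    fun a ha b hb hab => sqrt_lt_sqrt (hnonneg (hks.trans ha)) (hmono ha hb hab)
  refine ⟨ks, ⟨hks, hanti', hmono'⟩, fun y ⟨hy, hya, hym⟩ => ?_⟩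
  rcases lt_trichotomy y ks with h | h | h
  · exact (not_both hy h hym hanti').elim
  · exact h
  · exact (not_both hks h hmono' hya).elim
end
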